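/- The set B_{ℵ₀} ∩ ([(1+√5)/2, q_f) \ {q_2}) is a discrete set: every point of it has a neighbourhood in ℝ containing no other point of B_{ℵ₀} ∩ ([(1+√5)/2, q_f) \ {q_2}). -/

import Mathlib

noncomputable section

open Set

/-- The map `T_{q,i}(x) = q*x - i` for a binary digit `i`. -/
def Tmap (q : ℝ) (i : Fin 2) (x : ℝ) : ℝ := q * x - ((i : ℕ) : ℝ)

/-- The value `((ε_i)_{i=1}^∞)_q = ∑_{i=1}^∞ ε_i q^{-i}` of a binary sequence in base `q`
(the sequence is 0-indexed, so digit `ε i` has weight `q^{-(i+1)}`). -/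
def seqVal (q : ℝ) (ε : ℕ → Fin 2) : ℝ := ∑' i : ℕ, ((ε i : ℕ) : ℝ) / q ^ (i + 1)

/-- `Σ_q(x)`: the set of `q`-expansions of `x`. -/
def SigmaSet (q x : ℝ) : Set (ℕ → Fin 2) := {ε | x = seqVal q ε}

/-- The interval `I_q = [0, 1/(q-1)]`. -/
def Iq (q : ℝ) : Set ℝ := Icc 0 (1 / (q - 1))

/-- The switch region `S_q = [1/q, 1/(q(q-1))]`. -/
def Sq (q : ℝ) : Set ℝ := Icc (1 / q) (1 / (q * (q - 1)))

/-- The interval `J_q = [(q+q²)/(q⁴-1), (1+q³)/(q⁴-1)]`. -/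
def Jq (q : ℝ) : Set ℝ := Icc ((q + q ^ 2) / (q ^ 4 - 1)) ((1 + q ^ 3) / (q ^ 4 - 1))

/-- Apply the first `n` maps of a sequence of maps to `x`:
`applySeq a n x = (a_{n-1} ∘ ⋯ ∘ a_0)(x)`. -/
def applySeq (a : ℕ → ℝ → ℝ) (n : ℕ) (x : ℝ) : ℝ := (List.range n).foldl (fun y k => a k y) x

/-- `Ω_q(x)`: the set of sequences of maps, each equal to `T_{q,0}` or `T_{q,1}`,
all of whose partial compositions applied to `x` stay in `I_q`. -/
def OmegaSet (q x : ℝ) : Set (ℕ → ℝ → ℝ) :=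
  {a | (∀ n, a n = Tmap q 0 ∨ a n = Tmap q 1) ∧ ∀ n : ℕ, applySeq a (n + 1) x ∈ Iq q}

/-- Apply a finite word of digits to `x` (first letter applied first):
for `a = [a₁, …, aₙ]`, `wordMap q a x = (T_{q,aₙ} ∘ ⋯ ∘ T_{q,a₁})(x)`. -/
def wordMap (q : ℝ) (a : List (Fin 2)) (x : ℝ) : ℝ := a.foldl (fun y i => Tmap q i y) x

/-- A branching sequence for `x`: a finite word whose partial compositions applied to `x`
stay in `I_q`, and whose full composition maps `x` into the switch region `S_q`. -/
def IsBranching (q x : ℝ) (a : List (Fin 2)) : Prop :=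
  (∀ k, k ≤ a.length → wordMap q (a.take k) x ∈ Iq q) ∧ wordMap q a x ∈ Sq q

/-- `x` is a `q` null infinite point: `x ∈ (0,1/(q-1))`, `Ω_q(x)` is infinite, and for every
branching sequence `a` for `x` there is a digit `i` with `Ω_q(T_{q,i}(a(x)))` finite. -/
def NullInfinite (q x : ℝ) : Prop :=
  x ∈ Ioo 0 (1 / (q - 1)) ∧ (OmegaSet q x).Infinite ∧
    ∀ a : List (Fin 2), IsBranching q x a →
      ∃ i : Fin 2, (OmegaSet q (Tmap q i (wordMap q a x))).Finite

/-- `U_q`: points of `I_q` with exactly one `q`-expansion. -/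
def UniqSet (q : ℝ) : Set ℝ := {x | x ∈ Iq q ∧ ∃! ε : ℕ → Fin 2, ε ∈ SigmaSet q x}

/-- `B_{ℵ₀}`: bases `q ∈ (1,2)` for which some `x ∈ (0,1/(q-1))` has exactly countably
infinitely many `q`-expansions. -/
def BAleph0 : Set ℝ :=
  {q | q ∈ Ioo (1 : ℝ) 2 ∧ ∃ x ∈ Ioo (0 : ℝ) (1 / (q - 1)),
    Cardinal.mk ↥(SigmaSet q x) = Cardinal.aleph0}

/-- The eventually periodic binary sequence `u w^∞`: the finite word `u` followed by
infinitely many repetitions of the finite word `w`. -/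
def uwInf (u w : List (Fin 2)) : ℕ → Fin 2 := fun i =>
  if i < u.length then u.getD i 0 else w.getD ((i - u.length) % w.length) 0

open Filter Topology

theorem seqVal_summable {q : ℝ} (hq : 1 < q) (ε : ℕ → Fin 2) :
    Summable fun i : ℕ => ((ε i : ℕ) : ℝ) / q ^ (i + 1) := by
  have hg : Summable fun i : ℕ => (q⁻¹) ^ (i + 1) :=
    (summable_nat_add_iff 1).2
      (summable_geometric_of_lt_one (by positivity) (inv_lt_one_of_one_lt₀ hq))
  refine Summable.of_nonneg_of_le (fun i => by positivity) (fun i => ?_) hg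
  rw [inv_pow, ← one_div]
  have : ((ε i : ℕ) : ℝ) ≤ 1 := by exact_mod_cast Nat.le_of_lt_succ (ε i).2
  gcongr

theorem seqVal_nonneg {q : ℝ} (hq : 1 < q) (ε : ℕ → Fin 2) : 0 ≤ seqVal q ε :=
  tsum_nonneg fun i => by positivity

theorem seqVal_compl {q : ℝ} (hq : 1 < q) (ε : ℕ → Fin 2) :
    seqVal q (fun i => 1 - ε i) = 1 / (q - 1) - seqVal q ε := by
  have hsum : seqVal q (fun i => 1 - ε i) + seqVal q ε = 1 / (q - 1) := by
    unfold seqVal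
    rw [← (seqVal_summable hq _).tsum_add (seqVal_summable hq _)]
    have h1 : ∀ i : ℕ, (((1 - ε i : Fin 2) : ℕ) : ℝ) / q ^ (i + 1) + ((ε i : ℕ) : ℝ) / q ^ (i + 1)
        = q⁻¹ * (q⁻¹) ^ i := by
      intro i
      have : ∀ d : Fin 2, (((1 - d : Fin 2) : ℕ) : ℝ) + ((d : ℕ) : ℝ) = 1 := by
        intro d
        fin_cases d <;> simp
      rw [← add_div, this, ← pow_succ', inv_pow, one_div]
    simp_rw [h1]
    rw [tsum_mul_left, tsum_geometric_of_lt_one (by positivity) (inv_lt_one_of_one_lt₀ hq)]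
    have : q - 1 ≠ 0 := by linarith
    have : q ≠ 0 := by linarith
    field_simp
  linarith

theorem seqVal_mem_Iq {q : ℝ} (hq : 1 < q) (ε : ℕ → Fin 2) : seqVal q ε ∈ Iq q := by
  have h := seqVal_nonneg hq (fun i => 1 - ε i)
  rw [seqVal_compl hq] at h
  exact ⟨seqVal_nonneg hq ε, by linarith⟩

theorem seqVal_split {q : ℝ} (hq : 1 < q) (ε : ℕ → Fin 2) (m : ℕ) :
    seqVal q ε = ∑ i ∈ Finset.range m, ((ε i : ℕ) : ℝ) / q ^ (i + 1) +
      seqVal q (fun i => ε (i + m)) / q ^ m := by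
  unfold seqVal
  rw [← (seqVal_summable hq ε).sum_add_tsum_nat_add m, ← tsum_div_const]
  congr 2
  ext i
  rw [div_div, ← pow_add]
  ring_nf

theorem seqVal_step {q : ℝ} (hq : 1 < q) (ε : ℕ → Fin 2) :
    seqVal q (fun i => ε (i + 1)) = q * seqVal q ε - ((ε 0 : ℕ) : ℝ) := by
  have h := seqVal_split hq ε 1
  have : q ≠ 0 := by linarith
  rw [h]
  simp
  field_simp
  ring

/-- For sequences sharing a prefix, equality of values is equality of the values of the tails. -/
theorem seqVal_eq_iff_tail {q : ℝ} (hq : 1 < q) {ε δ : ℕ → Fin 2} {m : ℕ}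
    (h : ∀ i < m, ε i = δ i) :
    seqVal q ε = seqVal q δ ↔
      seqVal q (fun i => ε (i + m)) = seqVal q (fun i => δ (i + m)) := by
  have hs : ∑ i ∈ Finset.range m, ((ε i : ℕ) : ℝ) / q ^ (i + 1) =
      ∑ i ∈ Finset.range m, ((δ i : ℕ) : ℝ) / q ^ (i + 1) :=
    Finset.sum_congr rfl fun i hi => by rw [h i (Finset.mem_range.1 hi)]
  rw [seqVal_split hq ε m, seqVal_split hq δ m, hs]
  have : q ^ m ≠ 0 := by positivity
  constructor
  · intro h
    field_simp at h
    linarith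
  · intro h
    rw [h]

/-- The first `m` digits of `ε` followed by `δ`. -/
def glue (m : ℕ) (ε δ : ℕ → Fin 2) : ℕ → Fin 2 := fun i => if i < m then ε i else δ (i - m)

theorem glue_of_lt {m i : ℕ} (ε δ : ℕ → Fin 2) (h : i < m) : glue m ε δ i = ε i := by
  simp [glue, h]

theorem glue_add (m i : ℕ) (ε δ : ℕ → Fin 2) : glue m ε δ (i + m) = δ i := by
  simp [glue]

theorem seqVal_glue_eq_iff {q : ℝ} (hq : 1 < q) (m : ℕ) (ε δ : ℕ → Fin 2) :
    seqVal q ε = seqVal q (glue m ε δ) ↔ seqVal q (fun i => ε (i + m)) = seqVal q δ := by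
  rw [seqVal_eq_iff_tail hq (m := m) fun i hi => (glue_of_lt ε δ hi).symm]
  simp only [glue_add]

/-- Every point of `I_q` has a `q`-expansion. -/
theorem exists_seqVal_eq {q : ℝ} (hq : 1 < q) (hq2 : q < 2) {x : ℝ} (hx : x ∈ Iq q) :
    ∃ ε, x = seqVal q ε := by
  obtain ⟨a, ha⟩ : ∃ a, a = 1 / (q - 1) := ⟨_, rfl⟩
  have hq1 : 0 < q - 1 := by linarith
  have haq : a * (q - 1) = 1 := by rw [ha]; field_simp
  have ha1 : 1 ≤ a := by nlinarith
  let dg : ℝ → Fin 2 := fun y => if 1 ≤ q * y then 1 else 0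
  let s : ℕ → ℝ := fun n => (fun y => q * y - ((dg y : ℕ) : ℝ))^[n] x
  have hs0 : s 0 = x := rfl
  have hs : ∀ n, s (n + 1) = q * s n - ((dg (s n) : ℕ) : ℝ) := fun n =>
    Function.iterate_succ_apply' _ _ _
  have hmem : ∀ n, 0 ≤ s n ∧ s n ≤ a := by
    intro n
    induction n with
    | zero => rw [hs0, ha]; exact hx
    | succ n ih =>
      rw [hs]
      by_cases h : 1 ≤ q * s n
      · have hd : dg (s n) = 1 := if_pos h
        rw [hd]
        simp
        exact ⟨h, by nlinarith⟩
      · have hd : dg (s n) = 0 := if_neg h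
        rw [hd]
        simp
        exact ⟨by nlinarith, by linarith⟩
  refine ⟨fun n => dg (s n), ?_⟩
  have hpart : ∀ n, ∑ i ∈ Finset.range n, ((dg (s i) : ℕ) : ℝ) / q ^ (i + 1) = x - s n / q ^ n := by
    intro n
    induction n with
    | zero => simp [hs0]
    | succ n ih =>
      rw [Finset.sum_range_succ, ih, hs]
      have : q ≠ 0 := by linarith
      field_simp
      ring
  have hlim : Tendsto (fun n => x - s n / q ^ n) atTop (𝓝 x) := by
    have h0 : Tendsto (fun n : ℕ => a * (q⁻¹) ^ n) atTop (𝓝 0) := by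
      simpa using (tendsto_pow_atTop_nhds_zero_of_lt_one (r := q⁻¹) (by positivity)
        (inv_lt_one_of_one_lt₀ hq)).const_mul a
    have h1 : Tendsto (fun n => s n / q ^ n) atTop (𝓝 0) := by
      refine squeeze_zero (fun n => div_nonneg (hmem n).1 (by positivity)) (fun n => ?_) h0
      rw [div_eq_mul_inv, inv_pow]
      exact mul_le_mul_of_nonneg_right (hmem n).2 (by positivity)
    simpa using h1.const_sub x
  have hh := (seqVal_summable hq (fun n => dg (s n))).hasSum.tendsto_sum_nat
  simp_rw [hpart] at hh
  exact tendsto_nhds_unique hlim hh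

theorem Iq_symm {q x : ℝ} (hx : x ∈ Iq q) : 1 / (q - 1) - x ∈ Iq q :=
  ⟨by linarith [hx.2], by linarith [hx.1]⟩

theorem compl_compl_seq (ε : ℕ → Fin 2) : (fun i => 1 - (1 - ε i)) = ε := by
  ext1 i
  simp

theorem UniqSet_symm {q x : ℝ} (hq : 1 < q) (hx : x ∈ UniqSet q) : 1 / (q - 1) - x ∈ UniqSet q := by
  obtain ⟨hI, ε, hε, hu⟩ := hx
  refine ⟨Iq_symm hI, fun i => 1 - ε i, ?_, fun δ hδ => ?_⟩
  · change _ = _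
    rw [seqVal_compl hq, ← show x = seqVal q ε from hε]
  · have : (fun i => 1 - δ i) = ε := by
      apply hu
      change _ = _
      rw [seqVal_compl hq, ← show _ = seqVal q δ from hδ]
      ring
    rw [← this]
    exact (compl_compl_seq δ).symm

theorem UniqSet_step_digit {q : ℝ} (hq : 1 < q) (hq2 : q < 2) {ε : ℕ → Fin 2}
    (hu : ∀ δ, seqVal q ε = seqVal q δ → δ = ε) :
    seqVal q (fun i => ε (i + 1)) ∈ UniqSet q ∧
      q * seqVal q ε - (((1 - ε 0 : Fin 2) : ℕ) : ℝ) ∉ Iq q := by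
  refine ⟨⟨seqVal_mem_Iq hq _, _, rfl, fun δ hδ => ?_⟩, fun hI => ?_⟩
  · have h1 := hu _ ((seqVal_glue_eq_iff hq 1 ε δ).2 hδ)
    ext1 i
    rw [← glue_add 1 i ε δ, h1]
  · obtain ⟨δ, hδ⟩ := exists_seqVal_eq hq hq2 hI
    let η : ℕ → Fin 2 := glue 1 (fun _ => 1 - ε 0) δ
    have h0 : η 0 = 1 - ε 0 := glue_of_lt _ _ one_pos
    have hstep := seqVal_step hq η
    have ht : (fun i => η (i + 1)) = δ := by
      ext1 i
      exact glue_add 1 i _ _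
    rw [ht, ← hδ, h0] at hstep
    have heq : seqVal q ε = seqVal q η := by
      have : q ≠ 0 := by linarith
      have h2 : q * seqVal q ε = q * seqVal q η := by linarith
      exact mul_left_cancel₀ this h2
    have := congrFun (hu _ heq) 0
    rw [h0] at this
    revert this
    generalize ε 0 = d
    revert d
    decide

theorem UniqSet_step {q x : ℝ} (hq : 1 < q) (hq2 : q < 2) (hx : x ∈ UniqSet q) :
    (q * x ∈ UniqSet q ∧ q * x - 1 ∉ Iq q) ∨ (q * x - 1 ∈ UniqSet q ∧ q * x ∉ Iq q) := by
  obtain ⟨hI, ε, hε, hu⟩ := hx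
  have hε : x = seqVal q ε := hε
  subst hε
  obtain ⟨h1, h2⟩ := UniqSet_step_digit hq hq2 fun δ hδ => hu δ hδ
  rw [seqVal_step hq] at h1
  rcases (by generalize ε 0 = d; revert d; decide : ε 0 = 0 ∨ ε 0 = 1) with h | h
  · rw [h] at h1 h2
    left
    simpa using And.intro h1 h2
  · rw [h] at h1 h2
    right
    simpa using And.intro h1 h2

/-- A countable infinite closed subset of the Cantor space has an accumulation point which is
isolated among the accumulation points. -/
theorem exists_isolated_accumulation {K : Set (ℕ → Fin 2)} (hK : IsClosed K) (hc : K.Countable)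
    (hinf : K.Infinite) :
    ∃ ε ∈ K, ∃ n, (∀ m, ∃ δ ∈ K, δ ≠ ε ∧ ∀ i < m, δ i = ε i) ∧
      ∀ m ≥ n, {δ | δ ∈ K ∧ (∀ i < m, δ i = ε i) ∧ δ m ≠ ε m}.Finite := by
  have hDK : derivedSet K ⊆ K := (isClosed_iff_derivedSet_subset K).1 hK
  have hne : (derivedSet K).Nonempty := by
    obtain ⟨ε, -, hε⟩ := hinf.exists_accPt_of_subset_isCompact hK.isCompact subset_rfl
    exact ⟨ε, hε⟩
  have hnot : ¬ Preperfect (derivedSet K) := by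
    intro hp
    let := TopologicalSpace.upgradeIsCompletelyMetrizable (ℕ → Fin 2)
    obtain ⟨f, hf, -, hinj⟩ := Perfect.exists_nat_bool_injection
      ⟨isClosed_derivedSet K, hp⟩ hne
    have h1 : (range f).Countable := hc.mono (hf.trans hDK)
    have := h1.to_subtype
    have h2 : Countable (ℕ → Bool) := (Set.rangeFactorization_injective.2 hinj).countable
    rw [← Cardinal.mk_le_aleph0_iff] at h2
    simp at h2
    exact absurd h2 (not_le.2 Cardinal.aleph0_lt_continuum)
  obtain ⟨ε, hε, hiso⟩ : ∃ ε ∈ derivedSet K, ¬ AccPt ε (𝓟 (derivedSet K)) := by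
    unfold Preperfect at hnot
    push Not at hnot
    exact hnot
  rw [accPt_iff_nhds] at hiso
  push Not at hiso
  obtain ⟨V, hV, hVε⟩ := hiso
  obtain ⟨W, ⟨y, n, rfl⟩, hεW, hWV⟩ :=
    (PiNat.isTopologicalBasis_cylinders (fun _ : ℕ => Fin 2)).mem_nhds_iff.1 hV
  refine ⟨ε, hDK hε, n, fun m => ?_, fun m hm => ?_⟩
  · have hcyl : PiNat.cylinder ε m ∈ 𝓝 ε :=
      (PiNat.isOpen_cylinder _ ε m).mem_nhds (PiNat.self_mem_cylinder ε m)
    obtain ⟨δ, ⟨h1, h2⟩, h3⟩ := accPt_iff_nhds.1 hε _ hcyl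
    exact ⟨δ, h2, h3, h1⟩
  · by_contra hinf'
    obtain ⟨δ, -, hδ⟩ := Set.Infinite.exists_accPt_of_subset_isCompact hinf' hK.isCompact
      fun δ hδ => hδ.1
    have hδK : δ ∈ derivedSet K := hδ.mono (principal_mono.2 fun δ hδ => hδ.1)
    obtain ⟨η, ⟨hη1, -, hη2, hη3⟩, -⟩ := accPt_iff_nhds.1 hδ _
      ((PiNat.isOpen_cylinder _ δ (m + 1)).mem_nhds (PiNat.self_mem_cylinder δ (m + 1)))
    have hδm : δ m ≠ ε m := by
      rw [← hη1 m (Nat.lt_succ_self m)]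
      exact hη3
    refine hδm (congrFun (hVε δ ⟨hWV fun i hi => ?_, hδK⟩) m)
    rw [← hη1 i (by omega), hη2 i (by omega)]
    exact hεW i hi

theorem continuous_seqVal {q : ℝ} (hq : 1 < q) : Continuous (seqVal q) := by
  have hg : Summable fun i : ℕ => (q⁻¹) ^ (i + 1) :=
    (summable_nat_add_iff 1).2
      (summable_geometric_of_lt_one (by positivity) (inv_lt_one_of_one_lt₀ hq))
  refine continuous_tsum (fun i => ?_) hg fun i ε => ?_
  · have : Continuous fun d : Fin 2 => ((d : ℕ) : ℝ) := continuous_of_discreteTopology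
    exact (this.comp (continuous_apply i)).div_const _
  · rw [Real.norm_of_nonneg (by positivity), inv_pow, ← one_div]
    have : ((ε i : ℕ) : ℝ) ≤ 1 := by exact_mod_cast Nat.le_of_lt_succ (ε i).2
    gcongr

theorem seqVal_tail_step {q : ℝ} (hq : 1 < q) (ε : ℕ → Fin 2) (m : ℕ) :
    seqVal q (fun i => ε (i + (m + 1))) =
      q * seqVal q (fun i => ε (i + m)) - ((ε m : ℕ) : ℝ) := by
  have h := seqVal_step hq (fun i => ε (i + m))
  simp only [zero_add] at h
  rw [← h]
  congr 1
  ext1 i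
  ring_nf

theorem eq_zero_or_one_of_ne {d e : Fin 2} (h : d ≠ e) : (d = 0 ∧ e = 1) ∨ (d = 1 ∧ e = 0) := by
  revert d e
  decide

/-- If no point has two branches each having a unique expansion, then a point with finitely many
expansions has only one. -/
theorem mem_UniqSet_of_finite {q x : ℝ} (hq : 1 < q) (hq2 : q < 2)
    (hno : ∀ y, q * y ∈ UniqSet q → q * y - 1 ∉ UniqSet q) (hx : x ∈ Iq q)
    (hfin : (SigmaSet q x).Finite) : x ∈ UniqSet q := by
  obtain ⟨ε₀, hε₀⟩ := exists_seqVal_eq hq hq2 hx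
  refine ⟨hx, ε₀, hε₀, fun δ₀ hδ₀ => ?_⟩
  by_contra hne₀
  have hoff : (SigmaSet q x).offDiag.Finite := hfin.offDiag
  obtain ⟨⟨ε, δ⟩, ⟨hε, hδ, hne⟩, hmax⟩ := Set.exists_max_image _
    (fun p => PiNat.firstDiff p.1 p.2) hoff ⟨(δ₀, ε₀), hδ₀, hε₀, hne₀⟩
  replace hε : x = seqVal q ε := hε
  replace hδ : x = seqVal q δ := hδ
  replace hne : ε ≠ δ := hne
  set m := PiNat.firstDiff ε δ with hm
  have hagree : ∀ i < m, ε i = δ i := fun i hi => PiNat.apply_eq_of_lt_firstDiff hi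
  have hdiff : ε m ≠ δ m := PiNat.apply_firstDiff_ne hne
  have huniq : ∀ η, x = seqVal q η → seqVal q (fun i => η (i + (m + 1))) ∈ UniqSet q := by
    intro η hη
    refine ⟨seqVal_mem_Iq hq _, _, rfl, fun θ hθ => ?_⟩
    have hg : x = seqVal q (glue (m + 1) η θ) := by
      rw [hη]
      exact (seqVal_glue_eq_iff hq _ _ _).2 hθ
    by_contra hθη
    have hgη : glue (m + 1) η θ ≠ η := by
      intro h
      apply hθη
      ext1 i
      rw [← glue_add (m + 1) i η θ, h]
    have h1 : PiNat.firstDiff (glue (m + 1) η θ) η ≤ m := hmax (_, _) ⟨hg, hη, hgη⟩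
    exact PiNat.apply_firstDiff_ne hgη (glue_of_lt _ _ (by omega))
  have hy := (seqVal_eq_iff_tail hq hagree).1 (hε.symm.trans hδ)
  have h1 := huniq ε hε
  have h2 := huniq δ hδ
  rw [seqVal_tail_step hq] at h1 h2
  rw [← hy] at h2
  rcases eq_zero_or_one_of_ne hdiff with ⟨h, h'⟩ | ⟨h, h'⟩
  · rw [h] at h1
    rw [h'] at h2
    exact hno _ (by simpa using h1) (by simpa using h2)
  · rw [h] at h1
    rw [h'] at h2
    exact hno _ (by simpa using h2) (by simpa using h1)

/-- A set of points of `I_q` with several expansions, closed under reflection, each of whose points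
has one branch staying in the set, the other branch having at most one expansion. -/
structure IsNullOrbit (q : ℝ) (A : Set ℝ) : Prop where
  mem_Iq : ∀ x ∈ A, x ∈ Iq q
  not_mem_UniqSet : ∀ x ∈ A, x ∉ UniqSet q
  step : ∀ x ∈ A, (q * x ∈ A ∧ (q * x - 1 ∈ UniqSet q ∨ q * x - 1 ∉ Iq q)) ∨
    (q * x - 1 ∈ A ∧ (q * x ∈ UniqSet q ∨ q * x ∉ Iq q))
  symm : ∀ x ∈ A, 1 / (q - 1) - x ∈ A

theorem reflect_mul {q : ℝ} (hq : 1 < q) (x : ℝ) :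
    q * (1 / (q - 1) - x) - 1 = 1 / (q - 1) - q * x := by
  have : q - 1 ≠ 0 := by linarith
  field_simp
  ring

theorem reflect_mul_sub {q : ℝ} (hq : 1 < q) (x : ℝ) :
    q * (1 / (q - 1) - x) = 1 / (q - 1) - (q * x - 1) := by
  linarith [reflect_mul hq x]

theorem Iq_symm_iff {q x : ℝ} : 1 / (q - 1) - x ∈ Iq q ↔ x ∈ Iq q :=
  ⟨fun h => by simpa using Iq_symm h, Iq_symm⟩

/-- A base in `B_{ℵ₀}` in which no point has exactly two expansions admits a null orbit that meets
the switch region. -/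
theorem exists_isNullOrbit {q : ℝ} (hB : q ∈ BAleph0)
    (hno : ∀ y, q * y ∈ UniqSet q → q * y - 1 ∉ UniqSet q) :
    ∃ A, IsNullOrbit q A ∧ ∃ x ∈ A, 1 ≤ q * x ∧ q * x ≤ 1 / (q - 1) := by
  obtain ⟨⟨hq, hq2⟩, x, -, hx⟩ := hB
  have hcl : IsClosed (SigmaSet q x) := isClosed_eq continuous_const (continuous_seqVal hq)
  have hcount : (SigmaSet q x).Countable := Cardinal.le_aleph0_iff_set_countable.1 hx.le
  have hinf : (SigmaSet q x).Infinite :=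
    Set.infinite_coe_iff.1 (Cardinal.infinite_iff.2 hx.ge)
  obtain ⟨ε, hε, n, hacc, hside⟩ := exists_isolated_accumulation hcl hcount hinf
  replace hε : x = seqVal q ε := hε
  let z : ℕ → ℝ := fun m => seqVal q (fun i => ε (i + m))
  have hz : ∀ m, z (m + 1) = q * z m - ((ε m : ℕ) : ℝ) := seqVal_tail_step hq ε
  have hnotU : ∀ m, z m ∉ UniqSet q := by
    rintro m ⟨-, η, -, hη⟩
    obtain ⟨δ, hδ, hne, hag⟩ := hacc m
    replace hδ : x = seqVal q δ := hδ
    have h1 := (seqVal_eq_iff_tail hq hag).1 (hδ.symm.trans hε)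
    have h2 : (fun i => δ (i + m)) = η := hη _ h1.symm
    have h3 : (fun i => ε (i + m)) = η := hη _ rfl
    apply hne
    ext1 i
    rcases lt_or_ge i m with hi | hi
    · exact hag i hi
    · have := congrFun (h2.trans h3.symm) (i - m)
      simpa [Nat.sub_add_cancel hi] using this
  have hother : ∀ m ≥ n, q * z m - (((1 - ε m : Fin 2) : ℕ) : ℝ) ∈ Iq q →
      q * z m - (((1 - ε m : Fin 2) : ℕ) : ℝ) ∈ UniqSet q := by
    intro m hm hI
    refine mem_UniqSet_of_finite hq hq2 hno hI ?_
    refine ((hside m hm).image fun δ i => δ (i + (m + 1))).subset fun θ hθ => ?_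
    replace hθ : _ = seqVal q θ := hθ
    let τ : ℕ → Fin 2 := glue 1 (fun _ => 1 - ε m) θ
    have hτ0 : τ 0 = 1 - ε m := glue_of_lt _ _ one_pos
    have hτs : (fun i => τ (i + 1)) = θ := funext fun i => glue_add 1 i _ _
    have hτ : z m = seqVal q τ := by
      have h1 := seqVal_step hq τ
      rw [hτs, hτ0, ← hθ] at h1
      have : q ≠ 0 := by linarith
      exact mul_left_cancel₀ this (by linarith)
    refine ⟨glue m ε τ, ⟨?_, fun i hi => glue_of_lt _ _ hi, ?_⟩, ?_⟩
    · change x = _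
      rw [hε]
      exact (seqVal_glue_eq_iff hq m ε τ).2 hτ
    · have := glue_add m 0 ε τ
      rw [zero_add] at this
      rw [this, hτ0]
      generalize ε m = d
      revert d
      decide
    · ext1 i
      have := glue_add m (i + 1) ε τ
      rw [← congrFun hτs i, ← this]
      change glue m ε τ _ = _
      congr 1
      ring
  have hstep : ∀ m ≥ n, (q * z m = z (m + 1) ∧ (q * z m - 1 ∈ UniqSet q ∨ q * z m - 1 ∉ Iq q)) ∨
      (q * z m - 1 = z (m + 1) ∧ (q * z m ∈ UniqSet q ∨ q * z m ∉ Iq q)) := by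
    intro m hm
    have h1 := hother m hm
    have h2 := hz m
    rcases (by generalize ε m = d; revert d; decide : ε m = 0 ∨ ε m = 1) with h | h
    · rw [h] at h1 h2
      left
      simp at h1 h2
      exact ⟨h2.symm, by tauto⟩
    · rw [h] at h1 h2
      right
      simp at h1 h2
      exact ⟨h2.symm, by tauto⟩
  refine ⟨{y | ∃ m ≥ n, y = z m ∨ y = 1 / (q - 1) - z m}, ⟨?_, ?_, ?_, ?_⟩, ?_⟩
  · rintro y ⟨m, -, rfl | rfl⟩
    · exact seqVal_mem_Iq hq _
    · exact Iq_symm (seqVal_mem_Iq hq _)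
  · rintro y ⟨m, -, rfl | rfl⟩ hU
    · exact hnotU m hU
    · exact hnotU m (by simpa using UniqSet_symm hq hU)
  · rintro y ⟨m, hm, rfl | rfl⟩
    · rcases hstep m hm with ⟨h, h'⟩ | ⟨h, h'⟩
      · exact Or.inl ⟨⟨m + 1, by omega, Or.inl h⟩, h'⟩
      · exact Or.inr ⟨⟨m + 1, by omega, Or.inl h⟩, h'⟩
    · rw [reflect_mul hq, reflect_mul_sub hq, Iq_symm_iff, Iq_symm_iff]
      rcases hstep m hm with ⟨h, h'⟩ | ⟨h, h'⟩
      · exact Or.inr ⟨⟨m + 1, by omega, Or.inr (by rw [h])⟩, h'.imp_left (UniqSet_symm hq)⟩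
      · exact Or.inl ⟨⟨m + 1, by omega, Or.inr (by rw [h])⟩, h'.imp_left (UniqSet_symm hq)⟩
  · rintro y ⟨m, hm, rfl | rfl⟩
    · exact ⟨m, hm, Or.inr rfl⟩
    · exact ⟨m, hm, Or.inl (by ring)⟩
  · obtain ⟨δ, hδ, hne, hag⟩ := hacc n
    replace hδ : x = seqVal q δ := hδ
    set m := PiNat.firstDiff δ ε with hm
    have hdiff : δ m ≠ ε m := PiNat.apply_firstDiff_ne hne
    have hnm : n ≤ m := by
      by_contra h
      exact hdiff (hag m (by omega))
    have hag' : ∀ i < m, δ i = ε i := fun i hi => PiNat.apply_eq_of_lt_firstDiff hi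
    have hy := (seqVal_eq_iff_tail hq hag').1 (hδ.symm.trans hε)
    have h1 := seqVal_mem_Iq hq (fun i => ε (i + (m + 1)))
    have h2 := seqVal_mem_Iq hq (fun i => δ (i + (m + 1)))
    rw [seqVal_tail_step hq] at h1 h2
    rw [hy] at h2
    refine ⟨z m, ⟨m, hnm, Or.inl rfl⟩, ?_⟩
    rcases eq_zero_or_one_of_ne hdiff with ⟨h, h'⟩ | ⟨h, h'⟩
    · rw [h'] at h1
      rw [h] at h2
      simp only [Iq, mem_Icc, Fin.val_zero, Fin.val_one, Nat.cast_zero, Nat.cast_one, sub_zero,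
        sub_nonneg] at h1 h2
      exact ⟨h1.1, h2.2⟩
    · rw [h'] at h1
      rw [h] at h2
      simp only [Iq, mem_Icc, Fin.val_zero, Fin.val_one, Nat.cast_zero, Nat.cast_one, sub_zero,
        sub_nonneg] at h1 h2
      exact ⟨h2.1, h1.2⟩

/-- The value `(10)^∞` in base `q`. -/
def altVal (q : ℝ) : ℝ := q / (q ^ 2 - 1)

/-- The value `(0110)^∞` in base `q`: the left end of `J_q`. -/
def leftJ (q : ℝ) : ℝ := q / ((q - 1) * (q ^ 2 + 1))

/-- The base lies strictly between the golden ratio and `q_f`. -/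
structure InBand (q : ℝ) : Prop where
  one_lt : 1 < q
  lt_two : q < 2
  golden : q + 1 < q ^ 2
  cubic : q ^ 3 < 2 * q ^ 2 - q + 1

namespace InBand

variable {q : ℝ}

theorem end_mul (h : InBand q) : 1 / (q - 1) * (q - 1) = 1 := by
  have := h.one_lt
  field_simp [show q - 1 ≠ 0 by linarith]

theorem altVal_mul (h : InBand q) : altVal q * (q ^ 2 - 1) = q := by
  have := h.golden
  have := h.one_lt
  unfold altVal
  field_simp [show q ^ 2 - 1 ≠ 0 by nlinarith]

theorem altVal_pos (h : InBand q) : 0 < altVal q := by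
  have := h.golden
  have := h.one_lt
  exact div_pos (by linarith) (by linarith)

theorem altVal_lt_one (h : InBand q) : altVal q < 1 := by
  have := h.golden
  have := h.one_lt
  unfold altVal
  rw [div_lt_one (by linarith)]
  linarith

theorem end_lt (h : InBand q) : 1 / (q - 1) < q := by
  have := h.golden
  have := h.one_lt
  rw [div_lt_iff₀ (by linarith)]
  nlinarith

theorem one_lt_end (h : InBand q) : 1 < 1 / (q - 1) := by
  have := h.lt_two
  have := h.one_lt
  rw [lt_div_iff₀ (by linarith)]
  linarith

theorem one_lt_mul_sub (h : InBand q) : 1 < q * (q - 1) := by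
  nlinarith [h.golden]

theorem mul_sub_lt_end (h : InBand q) : q * (q - 1) < 1 / (q - 1) := by
  have := h.one_lt
  rw [lt_div_iff₀ (by linarith)]
  nlinarith [h.cubic]

theorem one_lt_sq_mul (h : InBand q) : 1 < q ^ 2 * (1 / (q - 1) - 1) := by
  have := h.one_lt
  have e : q ^ 2 * (1 / (q - 1) - 1) = q ^ 2 * (2 - q) / (q - 1) := by
    field_simp [show q - 1 ≠ 0 by linarith]
    ring
  rw [e, lt_div_iff₀ (by linarith)]
  nlinarith [h.cubic]

theorem mul_end_sub_lt (h : InBand q) : q * (1 / (q - 1) - 1) < 1 := by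
  have := h.one_lt
  have e : q * (1 / (q - 1) - 1) = q * (2 - q) / (q - 1) := by
    field_simp [show q - 1 ≠ 0 by linarith]
    ring
  rw [e, div_lt_iff₀ (by linarith)]
  nlinarith [h.golden]

theorem leftJ_eq (h : InBand q) : q ^ 2 * leftJ q - 1 = 1 / (q - 1) - leftJ q := by
  have := h.one_lt
  unfold leftJ
  field_simp [show q - 1 ≠ 0 by linarith]
  ring

theorem one_lt_mul_leftJ (h : InBand q) : 1 < q * leftJ q := by
  have := h.one_lt
  unfold leftJ
  rw [← mul_div_assoc, lt_div_iff₀ (mul_pos (by linarith) (by positivity))]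
  nlinarith [h.cubic]

theorem leftJ_le (h : InBand q) : 2 * leftJ q ≤ 1 / (q - 1) := by
  have := h.one_lt
  unfold leftJ
  rw [mul_div_assoc', div_le_div_iff₀ (mul_pos (by linarith) (by positivity)) (by linarith)]
  nlinarith [sq_nonneg (q - 1), mul_nonneg (sub_nonneg.2 this.le) (sq_nonneg (q - 1))]

theorem leftJ_mul_lt (h : InBand q) : q * leftJ q < 1 / (q - 1) := by
  have h1 := h.leftJ_le
  have h2 := h.one_lt_mul_leftJ
  have := h.one_lt
  have := h.lt_two
  have h3 : 0 < leftJ q := by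
    by_contra hc
    nlinarith
  nlinarith

/-- The sum of two expansions `0^k (10)^∞` never equals `1/(q-1) - 1`, except in base `q_2`. -/
theorem end_sub_one_ne (h : InBand q) (hq2 : q ^ 4 ≠ 2 * q ^ 2 + q + 1) (k j : ℕ) :
    1 / (q - 1) - 1 ≠ altVal q / q ^ k + altVal q / q ^ j := by
  have h1 := h.one_lt
  have h2 := h.lt_two
  have hg := h.golden
  have hc := h.cubic
  have hq0 : 0 < q := by linarith
  intro heq
  have e1 : (1 / (q - 1) - 1) * (q ^ 2 - 1) = 2 + q - q ^ 2 := by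
    linear_combination (q + 1) * h.end_mul
  have e2 : 2 + q - q ^ 2 = q / q ^ k + q / q ^ j := by
    rw [← e1, heq, add_mul, div_mul_eq_mul_div, div_mul_eq_mul_div, h.altVal_mul]
  have anti : ∀ {m n : ℕ}, m ≤ n → q / q ^ n ≤ q / q ^ m := fun hmn =>
    div_le_div_of_nonneg_left hq0.le (by positivity) (pow_le_pow_right₀ h1.le hmn)
  have hpos : ∀ n : ℕ, 0 < q / q ^ n := fun n => by positivity
  clear heq
  wlog hkj : k ≤ j generalizing k j
  · exact this j k (by rw [e2, add_comm]) (by omega)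
  have e3 : q / q ^ 1 = 1 := by field_simp
  have e4 : q / q ^ 2 = 1 / q := by field_simp
  have e5 : q / q ^ 3 = 1 / q ^ 2 := by field_simp
  have e6 : q / q ^ 4 = 1 / q ^ 3 := by field_simp
  have e7 : q / q ^ 5 = 1 / q ^ 4 := by field_simp
  rcases Nat.lt_or_ge k 2 with hk | hk
  · have := anti (show k ≤ 1 by omega)
    have := hpos j
    linarith
  rcases Nat.lt_or_ge 2 k with hk' | hk'
  · have i1 := anti (show 3 ≤ k by omega)
    have i2 := anti (show 3 ≤ j by omega)
    have i3 : (2 + q - q ^ 2) ≤ 2 / q ^ 2 := by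
      rw [e2]
      calc _ ≤ 1 / q ^ 2 + 1 / q ^ 2 := by linarith
        _ = _ := by ring
    rw [le_div_iff₀ (by positivity)] at i3
    nlinarith [mul_pos hq0 (sub_pos.2 h2), mul_pos hq0 hq0]
  have hk2 : k = 2 := by omega
  subst hk2
  rw [e4] at e2
  rcases Nat.lt_or_ge j 5 with hj | hj
  · interval_cases j
    · rw [e4] at e2
      field_simp at e2
      have : (q - 1) * (q ^ 2 - 2) = 0 := by linarith
      rcases mul_eq_zero.1 this with h | h <;> nlinarith
    · rw [e5] at e2
      field_simp at e2
      have : (q - 1) * ((q + 1) * (q ^ 2 - q - 1)) = 0 := by linarith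
      rcases mul_eq_zero.1 this with h | h
      · linarith
      · rcases mul_eq_zero.1 h with h | h <;> linarith
    · rw [e6] at e2
      field_simp at e2
      have : (q - 1) * (q ^ 4 - 2 * q ^ 2 - q - 1) = 0 := by linarith
      rcases mul_eq_zero.1 this with h | h
      · linarith
      · exact hq2 (by linarith)
  · have i1 := anti hj
    rw [e7] at i1
    have i2 : 2 + q - q ^ 2 ≤ 1 / q + 1 / q ^ 4 := by linarith
    have e8 : 1 / q + 1 / q ^ 4 = (q ^ 3 + 1) / q ^ 4 := by field_simp
    rw [e8, le_div_iff₀ (by positivity)] at i2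
    have : 0 < (2 * q ^ 2 - q + 1 - q ^ 3) * ((q + 1) ^ 2 * (q - 1)) :=
      mul_pos (by linarith) (mul_pos (by positivity) (by linarith))
    nlinarith

theorem end_sub_one_ne_single (h : InBand q) (k : ℕ) : 1 / (q - 1) - 1 ≠ altVal q / q ^ k := by
  have h1 := h.one_lt
  have hg := h.golden
  have hc := h.cubic
  have hq0 : 0 < q := by linarith
  intro heq
  have e1 : (1 / (q - 1) - 1) * (q ^ 2 - 1) = 2 + q - q ^ 2 := by
    linear_combination (q + 1) * h.end_mul
  have e2 : 2 + q - q ^ 2 = q / q ^ k := by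
    rw [← e1, heq, div_mul_eq_mul_div, h.altVal_mul]
  have anti : ∀ {m n : ℕ}, m ≤ n → q / q ^ n ≤ q / q ^ m := fun hmn =>
    div_le_div_of_nonneg_left hq0.le (by positivity) (pow_le_pow_right₀ h1.le hmn)
  rcases Nat.lt_or_ge k 2 with hk | hk
  · have := anti (show k ≤ 1 by omega)
    rw [pow_one, div_self hq0.ne'] at this
    linarith
  · have := anti hk
    rw [← e2, show q / q ^ 2 = 1 / q by field_simp, le_div_iff₀ hq0] at this
    nlinarith [mul_pos (sub_pos.2 h1) (sub_pos.2 h.lt_two), h.lt_two]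

end InBand

theorem UniqSet_lt {q u : ℝ} (h : InBand q) (hu : u ∈ UniqSet q) (h1 : q * u < 1) :
    q * u ∈ UniqSet q := by
  rcases UniqSet_step h.one_lt h.lt_two hu with h2 | h2
  · exact h2.1
  · have := h2.1.1.1
    linarith

theorem UniqSet_gt {q u : ℝ} (h : InBand q) (hu : u ∈ UniqSet q) (h1 : 1 / (q - 1) < q * u) :
    q * u - 1 ∈ UniqSet q := by
  rcases UniqSet_step h.one_lt h.lt_two hu with h2 | h2
  · have := h2.1.1.2
    linarith
  · exact h2.1

theorem UniqSet_not_switch {q u : ℝ} (h : InBand q) (hu : u ∈ UniqSet q) (h1 : 1 ≤ q * u) :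
    1 / (q - 1) < q * u := by
  have := h.one_lt
  rcases UniqSet_step h.one_lt h.lt_two hu with h2 | h2
  · by_contra h3
    exact h2.2 ⟨by linarith, by linarith⟩
  · by_contra h3
    exact h2.2 ⟨by linarith, by linarith⟩

/-- `q (q v - 1)` expands distances to `altVal q` by the factor `q²`. -/
theorem gap_expand {q : ℝ} (h : InBand q) (v : ℝ) :
    q * (q * v - 1) - altVal q = q ^ 2 * (v - altVal q) := by
  linear_combination h.altVal_mul

theorem gap_return {q v : ℝ} (h : InBand q) (h1 : 1 / (q - 1) < q * v) :
    q * (1 / (q - 1) - 1) < q * (q * v - 1) ∧ 1 ≤ q * (q * (q * v - 1)) := by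
  have := h.one_lt
  have h2 : q * (1 / (q - 1) - 1) < q * (q * v - 1) :=
    mul_lt_mul_of_pos_left (by linarith) (by linarith)
  refine ⟨h2, ?_⟩
  have := h.one_lt_sq_mul
  nlinarith

theorem UniqSet_gap {q v : ℝ} (h : InBand q) (hv : v ∈ UniqSet q) (h1 : 1 ≤ q * v) (h2 : v < 1) :
    v = altVal q := by
  have hq := h.one_lt
  have key : ∀ n : ℕ, ∀ v ∈ UniqSet q, 1 ≤ q * v → v < 1 → q ^ n * |v - altVal q| < 1 := by
    intro n
    induction n with
    | zero =>
      intro v hv h1 h2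
      rw [pow_zero, one_mul, abs_lt]
      have := h.altVal_pos
      have := h.altVal_lt_one
      have := hv.1.1
      exact ⟨by linarith, by linarith⟩
    | succ n ih =>
      intro v hv h1 h2
      have h3 := UniqSet_not_switch h hv h1
      have h4 := UniqSet_gt h hv h3
      have h5 : q * (q * v - 1) < 1 := by
        by_contra hc
        have h6 := UniqSet_not_switch h h4 (not_lt.1 hc)
        have := h.mul_sub_lt_end
        have h7 : q * (q * v - 1) < q * (q - 1) :=
          mul_lt_mul_of_pos_left (by nlinarith) (by linarith)
        have h8 : q * (q * v - 1) - 1 < q * (q * v - 1) := by linarith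
        linarith
      have h6 := ih _ (UniqSet_lt h h4 h5) (gap_return h h3).2 h5
      rw [gap_expand h, abs_mul, abs_of_pos (by positivity : 0 < q ^ 2)] at h6
      refine lt_of_le_of_lt ?_ h6
      rw [pow_succ, mul_assoc]
      gcongr
      nlinarith
  by_contra hne
  have hpos : 0 < |v - altVal q| := abs_pos.2 (sub_ne_zero.2 hne)
  obtain ⟨n, hn⟩ := pow_unbounded_of_one_lt (1 / |v - altVal q|) hq
  rw [div_lt_iff₀ hpos] at hn
  linarith [key n v hv h1 h2]

theorem exists_scale {q u : ℝ} (hq : 1 < q) (h0 : 0 < u) (h1 : u < 1) :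
    ∃ j : ℕ, 1 ≤ q * (q ^ j * u) ∧ q ^ j * u < 1 ∧ ∀ i < j, q * (q ^ i * u) < 1 := by
  have hex : ∃ j : ℕ, 1 ≤ q * (q ^ j * u) := by
    obtain ⟨n, hn⟩ := pow_unbounded_of_one_lt (1 / u) hq
    refine ⟨n, ?_⟩
    rw [div_lt_iff₀ h0] at hn
    nlinarith
  classical
  refine ⟨Nat.find hex, Nat.find_spec hex, ?_, fun i hi => not_le.1 (Nat.find_min hex hi)⟩
  rcases Nat.eq_zero_or_pos (Nat.find hex) with h | h
  · rw [h]
    simpa using h1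
  · obtain ⟨k, hk⟩ := Nat.exists_eq_succ_of_ne_zero h.ne'
    have := not_le.1 (Nat.find_min hex (show k < Nat.find hex by omega))
    rw [hk, pow_succ']
    linarith

theorem UniqSet_small {q u : ℝ} (h : InBand q) (hu : u ∈ UniqSet q) (h0 : 0 < u) (h1 : u < 1) :
    ∃ k : ℕ, u = altVal q / q ^ k := by
  have hq := h.one_lt
  obtain ⟨j, hj1, hj2, hj3⟩ := exists_scale hq h0 h1
  have hmem : ∀ i ≤ j, q ^ i * u ∈ UniqSet q := by
    intro i
    induction i with
    | zero => simpa using hu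
    | succ i ih =>
      intro hi
      rw [pow_succ', mul_assoc]
      exact UniqSet_lt h (ih (by omega)) (hj3 i hi)
  refine ⟨j, ?_⟩
  rw [eq_div_iff (by positivity), ← UniqSet_gap h (hmem j le_rfl) hj1 hj2]
  ring

/-- Outside base `q_2`, no point has exactly two expansions branching immediately. -/
theorem not_both_UniqSet {q : ℝ} (h : InBand q) (hq2 : q ^ 4 ≠ 2 * q ^ 2 + q + 1) (y : ℝ)
    (h1 : q * y ∈ UniqSet q) : q * y - 1 ∉ UniqSet q := by
  intro h2
  have hq := h.one_lt
  have h3 := UniqSet_symm hq h1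
  have hlt : 1 / (q - 1) - 1 < 1 := by
    have := h.mul_end_sub_lt
    have := h.one_lt_end
    nlinarith
  have hpos := h.one_lt_end
  have hu0 := h2.1.1
  have hv0 := h3.1.1
  rcases hu0.eq_or_lt with hu | hu
  · obtain ⟨k, hk⟩ := UniqSet_small h h3 (by linarith) (by linarith)
    exact h.end_sub_one_ne_single k (by linarith)
  obtain ⟨k, hk⟩ := UniqSet_small h h2 hu (by linarith)
  rcases hv0.eq_or_lt with hv | hv
  · exact h.end_sub_one_ne_single k (by linarith)
  obtain ⟨j, hj⟩ := UniqSet_small h h3 hv (by linarith)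
  exact h.end_sub_one_ne hq2 k j (by linarith)

/-- `y` is the image of `x` under a composition of at most `n` of the maps `T_{q,0}`, `T_{q,1}`. -/
def Reach (q : ℝ) (n : ℕ) (x y : ℝ) : Prop :=
  ∃ w : List (Fin 2), w.length ≤ n ∧ wordMap q w x = y

theorem Reach.refl (q x : ℝ) : Reach q 0 x x := ⟨[], le_rfl, rfl⟩

theorem Reach.mono {q x y : ℝ} {m n : ℕ} (h : Reach q m x y) (hmn : m ≤ n) : Reach q n x y := by
  obtain ⟨w, hw, e⟩ := h
  exact ⟨w, hw.trans hmn, e⟩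

theorem Reach.trans {q x y z : ℝ} {m n : ℕ} (h : Reach q m x y) (h' : Reach q n y z) :
    Reach q (m + n) x z := by
  obtain ⟨w, hw, rfl⟩ := h
  obtain ⟨w', hw', rfl⟩ := h'
  refine ⟨w ++ w', by simp; omega, ?_⟩
  simp [wordMap, List.foldl_append]

theorem Reach.mul (q x : ℝ) : Reach q 1 x (q * x) := ⟨[0], by simp, by simp [wordMap, Tmap]⟩

theorem Reach.mul_sub (q x : ℝ) : Reach q 1 x (q * x - 1) :=
  ⟨[1], by simp, by simp [wordMap, Tmap]⟩

theorem Reach.pow_mul (q x : ℝ) (n : ℕ) : Reach q n x (q ^ n * x) := by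
  induction n with
  | zero => simpa using Reach.refl q x
  | succ n ih =>
    have := ih.trans (Reach.mul q _)
    rwa [← mul_assoc, ← pow_succ'] at this

theorem wordMap_reflect {q : ℝ} (hq : 1 < q) (w : List (Fin 2)) (x : ℝ) :
    wordMap q (w.map (1 - ·)) (1 / (q - 1) - x) = 1 / (q - 1) - wordMap q w x := by
  induction w generalizing x with
  | nil => rfl
  | cons d w ih =>
    have hd : Tmap q (1 - d) (1 / (q - 1) - x) = 1 / (q - 1) - Tmap q d x := by
      have h1 := reflect_mul hq x
      fin_cases d <;> simp [Tmap] at h1 ⊢ <;> linarith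
    change wordMap q (w.map (1 - ·)) (Tmap q (1 - d) (1 / (q - 1) - x)) = _
    rw [hd, ih]
    rfl

theorem Reach.reflect {q x y : ℝ} {n : ℕ} (hq : 1 < q) (h : Reach q n x y) :
    Reach q n (1 / (q - 1) - x) (1 / (q - 1) - y) := by
  obtain ⟨w, hw, rfl⟩ := h
  exact ⟨w.map (1 - ·), by simpa using hw, wordMap_reflect hq w x⟩

namespace IsNullOrbit

variable {q : ℝ} {A : Set ℝ}

theorem lt (hA : IsNullOrbit q A) {x : ℝ} (hx : x ∈ A) (h1 : q * x < 1) : q * x ∈ A := by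
  rcases hA.step x hx with h2 | h2
  · exact h2.1
  · have := (hA.mem_Iq _ h2.1).1
    linarith

theorem gt (hA : IsNullOrbit q A) {x : ℝ} (hx : x ∈ A) (h1 : 1 / (q - 1) < q * x) :
    q * x - 1 ∈ A := by
  rcases hA.step x hx with h2 | h2
  · have := (hA.mem_Iq _ h2.1).2
    linarith
  · exact h2.1

theorem switch (hA : IsNullOrbit q A) (h : InBand q) {x : ℝ} (hx : x ∈ A) (h1 : 1 ≤ q * x)
    (h2 : q * x ≤ 1 / (q - 1)) :
    (q * x ∈ A ∧ q * x - 1 ∈ UniqSet q) ∨ (q * x - 1 ∈ A ∧ q * x ∈ UniqSet q) := by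
  have := h.one_lt
  have h3 : q * x ∈ Iq q := ⟨by linarith, h2⟩
  have h4 : q * x - 1 ∈ Iq q := ⟨by linarith, by linarith⟩
  rcases hA.step x hx with h5 | h5
  · exact Or.inl ⟨h5.1, h5.2.resolve_right fun hc => hc h4⟩
  · exact Or.inr ⟨h5.1, h5.2.resolve_right fun hc => hc h3⟩

/-- On the part of the switch region to the left of `J_q` the orbit follows `T_{q,1} ∘ T_{q,0}`. -/
theorem left_step (hA : IsNullOrbit q A) (h : InBand q) {x : ℝ} (hx : x ∈ A) (h1 : 1 ≤ q * x)
    (h2 : x < leftJ q) :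
    q * x - 1 ∈ UniqSet q ∧ q * (q * x) - 1 ∈ A ∧ 1 ≤ q * (q * (q * x) - 1) ∧
      q * (q * x) - 1 < 1 / (q - 1) - leftJ q := by
  have hq := h.one_lt
  have hJ := h.leftJ_mul_lt
  have h3 : q * x < q * leftJ q := mul_lt_mul_of_pos_left h2 (by linarith)
  have h4 : 1 / (q - 1) < q * (q * x) := by nlinarith [h.end_lt]
  have h5 : 1 ≤ q * (q * (q * x) - 1) := by nlinarith [h.one_lt_mul_sub]
  have h6 : q * (q * x) - 1 < 1 / (q - 1) - leftJ q := by
    rw [← h.leftJ_eq]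
    nlinarith
  rcases hA.switch h hx h1 (by linarith) with h7 | h7
  · exact ⟨h7.2, hA.gt h7.1 h4, h5, h6⟩
  · exfalso
    have h8 := UniqSet_not_switch h (UniqSet_gt h h7.2 h4) h5
    have := h.end_mul
    have := h.one_lt_mul_leftJ
    nlinarith

theorem left_to_J (hA : IsNullOrbit q A) (h : InBand q) {x : ℝ} (hx : x ∈ A) (h1 : 1 ≤ q * x)
    (h2 : x < leftJ q) :
    ∃ y ∈ A, Reach q 4 x y ∧ leftJ q ≤ y ∧ y ≤ 1 / (q - 1) - leftJ q ∧
      y ≤ q * (q * (q * (q * x) - 1)) - 1 := by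
  have hq := h.one_lt
  obtain ⟨a1, a2, a3, a4⟩ := hA.left_step h hx h1 h2
  set f := q * (q * x) - 1 with hf
  have hr : Reach q 2 x f := (Reach.mul q x).trans (Reach.mul_sub q _)
  by_cases hc : leftJ q ≤ f
  · refine ⟨f, a2, hr.mono (by norm_num), hc, a4.le, ?_⟩
    nlinarith [h.one_lt_mul_sub]
  obtain ⟨b1, b2, b3, b4⟩ := hA.left_step h a2 a3 (not_le.1 hc)
  set g := q * (q * f) - 1 with hg
  have hr' : Reach q 4 x g := hr.trans ((Reach.mul q f).trans (Reach.mul_sub q _))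
  refine ⟨g, b2, hr', ?_, b4.le, le_rfl⟩
  by_contra hc'
  obtain ⟨c1, -⟩ := hA.left_step h b2 b3 (not_le.1 hc')
  have hJ := h.leftJ_mul_lt
  have hlt : q * leftJ q - 1 < 1 := by
    have := h.mul_end_sub_lt
    have := h.one_lt_end
    nlinarith
  have e1 : q * f - 1 = q ^ 2 * (q * x - 1) + (q ^ 2 - q - 1) := by rw [hf]; ring
  have e2 : q * g - 1 = q ^ 2 * (q * f - 1) + (q ^ 2 - q - 1) := by rw [hg]; ring
  have hd : 0 < q ^ 2 - q - 1 := by linarith [h.golden]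
  have p0 : 0 ≤ q ^ 2 * (q * x - 1) := mul_nonneg (by positivity) (by linarith)
  have p1 : 0 < q * f - 1 := by linarith
  have p2 : 0 < q ^ 2 * (q * f - 1) := by positivity
  obtain ⟨k, hk⟩ := UniqSet_small h b1 p1 (by nlinarith)
  obtain ⟨j, hj⟩ := UniqSet_small h c1 (by linarith) (by nlinarith)
  set s := q * f - 1 with hs
  set t := q * g - 1 with ht
  have hp := h.altVal_pos
  have hst : t * q ^ j = s * q ^ k := by
    rw [hj, hk]
    field_simp
  have hjk : j + 3 ≤ k := by
    by_contra hlt'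
    have h6 : q ^ k ≤ q ^ (j + 2) := pow_le_pow_right₀ hq.le (by omega)
    rw [pow_add] at h6
    have h7 : 0 < q ^ j := by positivity
    nlinarith
  have h8 : q ^ (j + 3) ≤ q ^ k := pow_le_pow_right₀ hq.le hjk
  have h9 : q ^ 3 * s ≤ t := by
    have h7 : 0 < q ^ j := by positivity
    rw [pow_add] at h8
    have : (q ^ 3 * s) * q ^ j ≤ t * q ^ j := by
      rw [hst]
      nlinarith
    exact le_of_mul_le_mul_right this h7
  nlinarith [h.one_lt_mul_sub, mul_pos p1 (sub_pos.2 hq), mul_pos p1 (sub_pos.2 h.one_lt_mul_sub)]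

theorem switch_to_J (hA : IsNullOrbit q A) (h : InBand q) {x : ℝ} (hx : x ∈ A) (h1 : 1 ≤ q * x)
    (h2 : q * x ≤ 1 / (q - 1)) :
    ∃ y ∈ A, Reach q 4 x y ∧ leftJ q ≤ y ∧ y ≤ 1 / (q - 1) - leftJ q := by
  have hq := h.one_lt
  by_cases hl : x < leftJ q
  · obtain ⟨y, b1, b2, b3, b4, -⟩ := hA.left_to_J h hx h1 hl
    exact ⟨y, b1, b2, b3, b4⟩
  by_cases hr : 1 / (q - 1) - leftJ q < x
  · obtain ⟨y, b1, b2, b3, b4, -⟩ := hA.left_to_J h (hA.symm x hx)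
      (by linarith [reflect_mul_sub hq x]) (by linarith)
    refine ⟨_, hA.symm y b1, ?_, by linarith, by linarith⟩
    simpa using b2.reflect hq
  · exact ⟨x, hx, (Reach.refl q x).mono (by norm_num), by linarith, by linarith⟩

theorem switch_ge (hA : IsNullOrbit q A) (h : InBand q) {x : ℝ} (hx : x ∈ A) (h1 : 1 ≤ q * x) :
    leftJ q + 1 + q ^ 2 ≤ q ^ 4 * x := by
  by_cases hl : x < leftJ q
  · obtain ⟨y, -, -, b3, -, b5⟩ := hA.left_to_J h hx h1 hl
    nlinarith
  · have := h.leftJ_eq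
    have := h.leftJ_le
    have := h.one_lt
    have h3 : q ^ 4 * leftJ q ≤ q ^ 4 * x := by
      have := not_lt.1 hl
      gcongr
    have h4 : q ^ 2 * leftJ q ≤ q ^ 2 * (q ^ 2 * leftJ q - 1) := by
      gcongr
      linarith
    nlinarith

theorem switch_le (hA : IsNullOrbit q A) (h : InBand q) {x : ℝ} (hx : x ∈ A)
    (h2 : q * x ≤ 1 / (q - 1)) :
    leftJ q + 1 + q ^ 2 ≤ q ^ 4 * (1 / (q - 1) - x) :=
  hA.switch_ge h (hA.symm x hx) (by linarith [reflect_mul_sub h.one_lt x])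

/-- A point of the orbit in `[1/q, 1)` away from `altVal q` reaches the switch region in bounded
time, entering it at the first step or near one of its ends. -/
theorem gap_to_switch (hA : IsNullOrbit q A) (h : InBand q) (M : ℕ) {v : ℝ} (hv : v ∈ A)
    (h1 : 1 ≤ q * v) (h2 : v < 1) (hM : 1 ≤ q ^ (2 * M) * |v - altVal q|) :
    ∃ y ∈ A, Reach q (2 * M) v y ∧ 1 ≤ q * y ∧ q * y ≤ 1 / (q - 1) ∧
      (y = v ∨ y ≤ q - 1 ∨ q * (1 / (q - 1) - 1) < y) := by
  have hq := h.one_lt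
  induction M generalizing v with
  | zero =>
    exfalso
    have := h.altVal_pos
    have := h.altVal_lt_one
    have := (hA.mem_Iq v hv).1
    have : |v - altVal q| < 1 := abs_lt.2 ⟨by linarith, by linarith⟩
    simp at hM
    linarith
  | succ M ih =>
    by_cases hs : q * v ≤ 1 / (q - 1)
    · exact ⟨v, hv, (Reach.refl q v).mono (by omega), h1, hs, Or.inl rfl⟩
    have hs' := not_le.1 hs
    have hw := hA.gt hv hs'
    have hwq : q * v - 1 ≤ q - 1 := by nlinarith
    by_cases hw1 : 1 ≤ q * (q * v - 1)
    · refine ⟨_, hw, (Reach.mul_sub q v).mono (by omega), hw1, ?_, Or.inr (Or.inl hwq)⟩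
      have := h.mul_sub_lt_end
      nlinarith
    have hw2 := not_le.1 hw1
    obtain ⟨g1, g2⟩ := gap_return h hs'
    obtain ⟨y, b1, b2, b3, b4, b5⟩ := ih (hA.lt hw hw2) g2 hw2 (by
      rw [gap_expand h, abs_mul, abs_of_pos (by positivity : 0 < q ^ 2), ← mul_assoc, ← pow_add]
      exact hM)
    refine ⟨y, b1, ?_, b3, b4, ?_⟩
    · exact (((Reach.mul_sub q v).trans (Reach.mul q _)).trans b2).mono (by omega)
    · rcases b5 with rfl | b5
      · exact Or.inr (Or.inr g1)
      · exact Or.inr b5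

end IsNullOrbit

namespace IsNullOrbit

variable {q : ℝ} {A : Set ℝ}

theorem digit_form (h : InBand q) {K : ℕ} (hK : 1 ≤ q ^ K * (q * leftJ q - 1)) {y : ℝ}
    (hu : q * y - 1 ∈ UniqSet q) (h1 : leftJ q ≤ y) (h2 : y ≤ 1 / (q - 1) - leftJ q) :
    ∃ k < K, q * y = 1 + altVal q / q ^ k := by
  have hq := h.one_lt
  have hl := h.one_lt_mul_leftJ
  have h3 : q * leftJ q ≤ q * y := by gcongr
  have h4 : q * y ≤ q * (1 / (q - 1) - leftJ q) := by gcongr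
  have h5 := reflect_mul hq (leftJ q)
  have h6 : 1 / (q - 1) - 1 < 1 := by
    nlinarith [h.mul_end_sub_lt, h.one_lt_end]
  obtain ⟨k, hk⟩ := UniqSet_small h hu (by linarith) (by linarith)
  refine ⟨k, ?_, by linarith⟩
  by_contra hc
  have h7 : q ^ K ≤ q ^ k := pow_le_pow_right₀ hq.le (not_lt.1 hc)
  have h8 : q ^ K * (q * leftJ q - 1) ≤ q ^ k * (q * y - 1) := by
    gcongr
  rw [hk, mul_div_cancel₀ _ (by positivity)] at h8
  linarith [h.altVal_lt_one]

/-- A point of the orbit in `J_q`, or its reflection, has the form `(1 + (0^k (10)^∞)) / q`. -/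
theorem J_form (hA : IsNullOrbit q A) (h : InBand q) {K : ℕ}
    (hK : 1 ≤ q ^ K * (q * leftJ q - 1)) {y : ℝ} (hy : y ∈ A) (h1 : leftJ q ≤ y)
    (h2 : y ≤ 1 / (q - 1) - leftJ q) :
    ∃ k < K, (q * y ∈ A ∧ q * y = 1 + altVal q / q ^ k) ∨
      (q * (1 / (q - 1) - y) ∈ A ∧ q * (1 / (q - 1) - y) = 1 + altVal q / q ^ k) := by
  have hq := h.one_lt
  have hl := h.one_lt_mul_leftJ
  have h3 : q * leftJ q ≤ q * y := by gcongr
  have h4 : q * y ≤ q * (1 / (q - 1) - leftJ q) := by gcongr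
  have h5 := reflect_mul hq (leftJ q)
  rcases hA.switch h hy (by linarith) (by linarith) with h6 | h6
  · obtain ⟨k, hk, e⟩ := digit_form h hK h6.2 h1 h2
    exact ⟨k, hk, Or.inl ⟨h6.1, e⟩⟩
  · have h7 := hA.symm _ h6.1
    rw [← reflect_mul_sub hq] at h7
    have h8 := UniqSet_symm hq h6.2
    rw [← reflect_mul hq] at h8
    obtain ⟨k, hk, e⟩ := digit_form h hK h8 (by linarith) (by linarith)
    exact ⟨k, hk, Or.inr ⟨h7, e⟩⟩

theorem scale_mem (hA : IsNullOrbit q A) {v : ℝ} (hv : v ∈ A) {j : ℕ}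
    (hj : ∀ i < j, q * (q ^ i * v) < 1) : q ^ j * v ∈ A := by
  induction j with
  | zero => simpa using hv
  | succ j ih =>
    rw [pow_succ', mul_assoc]
    exact hA.lt (ih fun i hi => hj i (by omega)) (hj j (by omega))

/-- The orbit comes back from `J_q` to `J_q` in bounded time. -/
theorem J_return (hA : IsNullOrbit q A) (h : InBand q) {K M : ℕ}
    (hK : 1 ≤ q ^ K * (q * leftJ q - 1)) {x : ℝ} {k : ℕ} (hx : q * x ∈ A)
    (e : q * x = 1 + altVal q / q ^ k)
    (hM : ∀ j < K, 1 ≤ q ^ (2 * M) * |q ^ j * (1 / (q - 1) - 1 - altVal q / q ^ k) - altVal q|)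
    (h1 : leftJ q ≤ x) (h2 : x ≤ 1 / (q - 1) - leftJ q) :
    ∃ y ∈ A, Reach q (K + 2 * M + 4) (q * x) y ∧ leftJ q ≤ y ∧ y ≤ 1 / (q - 1) - leftJ q := by
  have hq := h.one_lt
  have hl := h.one_lt_mul_leftJ
  have h3 : q * leftJ q ≤ q * x := by gcongr
  have h4 : q * x ≤ q * (1 / (q - 1) - leftJ q) := by gcongr
  have h5 := reflect_mul hq (leftJ q)
  have h6 : 1 / (q - 1) - 1 < 1 := by
    nlinarith [h.mul_end_sub_lt, h.one_lt_end]
  have hv := hA.symm _ hx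
  have hve : 1 / (q - 1) - q * x = 1 / (q - 1) - 1 - altVal q / q ^ k := by linarith
  have hv0 : q * leftJ q - 1 ≤ 1 / (q - 1) - q * x := by linarith
  rw [hve] at hv hv0
  set v := 1 / (q - 1) - 1 - altVal q / q ^ k with hvd
  obtain ⟨j, hj1, hj2, hj3⟩ := exists_scale hq (show 0 < v by linarith) (by linarith)
  have hjK : j < K := by
    by_contra hc
    have h7 : q ^ K ≤ q ^ j := pow_le_pow_right₀ hq.le (not_lt.1 hc)
    have h8 : q ^ K * (q * leftJ q - 1) ≤ q ^ j * v := by gcongr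
    linarith
  obtain ⟨y, y1, y2, y3, y4, -⟩ := hA.gap_to_switch h M (hA.scale_mem hv hj3) hj1 hj2 (hM j hjK)
  obtain ⟨z, z1, z2, z3, z4⟩ := hA.switch_to_J h y1 y3 y4
  refine ⟨_, hA.symm z z1, ?_, by linarith, by linarith⟩
  have h9 := ((((Reach.pow_mul q v j).trans y2).trans z2).mono
    (show j + 2 * M + 4 ≤ K + 2 * M + 4 by omega)).reflect hq
  rwa [← hve, sub_sub_cancel] at h9

end IsNullOrbit

/-- The existence of a null orbit forces one of finitely many algebraic relations on the base. -/
theorem IsNullOrbit.exists_relation {q : ℝ} {A : Set ℝ} (hA : IsNullOrbit q A) (h : InBand q)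
    {K M : ℕ} (hK : 1 ≤ q ^ K * (q * leftJ q - 1))
    (hM : ∀ k < K, ∀ j < K,
      1 ≤ q ^ (2 * M) * |q ^ j * (1 / (q - 1) - 1 - altVal q / q ^ k) - altVal q|)
    (hS : ∃ x ∈ A, 1 ≤ q * x ∧ q * x ≤ 1 / (q - 1)) :
    ∃ w : List (Fin 2), w.length ≤ K + 2 * M + 4 ∧ ∃ k < K, ∃ k' < K,
      wordMap q w (1 + altVal q / q ^ k) = (1 + altVal q / q ^ k') / q ∨
      wordMap q w (1 + altVal q / q ^ k) = 1 / (q - 1) - (1 + altVal q / q ^ k') / q := by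
  have hq := h.one_lt
  obtain ⟨x, hx, hx1, hx2⟩ := hS
  obtain ⟨y, y1, -, y3, y4⟩ := hA.switch_to_J h hx hx1 hx2
  obtain ⟨z, z1, z2, k, hk, z3, z4⟩ : ∃ z, leftJ q ≤ z ∧ z ≤ 1 / (q - 1) - leftJ q ∧
      ∃ k < K, q * z ∈ A ∧ q * z = 1 + altVal q / q ^ k := by
    obtain ⟨k, hk, h6 | h6⟩ := hA.J_form h hK y1 y3 y4
    · exact ⟨y, y3, y4, k, hk, h6⟩
    · exact ⟨_, by linarith, by linarith, k, hk, h6⟩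
  obtain ⟨y', b1, ⟨w, hw, e⟩, b3, b4⟩ := hA.J_return h hK z3 z4 (hM k hk) z1 z2
  obtain ⟨k', hk', h6⟩ := hA.J_form h hK b1 b3 b4
  refine ⟨w, hw, k, hk, k', hk', ?_⟩
  rw [← z4, e]
  rcases h6 with h6 | h6
  · left
    rw [eq_div_iff (by linarith), mul_comm, h6.2]
  · right
    rw [← h6.2, mul_div_cancel_left₀ _ (by linarith)]
    ring

theorem analyticAt_altVal {q : ℝ} (hq : 1 < q) : AnalyticAt ℝ altVal q :=
  analyticAt_id.div ((analyticAt_id.pow 2).sub analyticAt_const)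
    (show 0 < q ^ 2 - 1 by nlinarith).ne'

theorem analyticAt_wordMap {q : ℝ} (w : List (Fin 2)) {f : ℝ → ℝ} (hf : AnalyticAt ℝ f q) :
    AnalyticAt ℝ (fun q => wordMap q w (f q)) q := by
  induction w generalizing f with
  | nil => exact hf
  | cons d w ih => exact ih ((analyticAt_id.mul hf).sub analyticAt_const)

theorem one_le_wordMap {q : ℝ} (hq : 2 ≤ q) (w : List (Fin 2)) {x : ℝ} (hx : 1 ≤ x) :
    1 ≤ wordMap q w x := by
  induction w generalizing x with
  | nil => exact hx
  | cons d w ih =>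
    refine ih ?_
    have : (((d : ℕ) : ℝ)) ≤ 1 := by exact_mod_cast (by omega : (d : ℕ) ≤ 1)
    change 1 ≤ q * x - _
    nlinarith

theorem eventually_ne_zero_of_analytic {F : ℝ → ℝ} (hF : ∀ q, 1 < q → AnalyticAt ℝ F q) {q₁ : ℝ}
    (h1 : 1 < q₁) (hne : F q₁ ≠ 0) {q : ℝ} (hq : 1 < q) : ∀ᶠ q' in 𝓝[≠] q, F q' ≠ 0 := by
  rcases (hF q hq).eventually_eq_zero_or_eventually_ne_zero with h | h
  · have hF' : AnalyticOnNhd ℝ F (Ioi 1) := fun q hq => hF q hq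
    exact absurd (hF'.eqOn_zero_of_preconnected_of_eventuallyEq_zero isPreconnected_Ioi hq h h1) hne
  · exact h

theorem relation_eventually_ne {q : ℝ} (hq : 1 < q) (w : List (Fin 2)) (k k' : ℕ) :
    ∀ᶠ q' in 𝓝[≠] q,
      wordMap q' w (1 + altVal q' / q' ^ k) ≠ (1 + altVal q' / q' ^ k') / q' ∧
      wordMap q' w (1 + altVal q' / q' ^ k) ≠ 1 / (q' - 1) - (1 + altVal q' / q' ^ k') / q' := by
  have hT : ∀ {q : ℝ} (k : ℕ), 1 < q → AnalyticAt ℝ (fun q => 1 + altVal q / q ^ k) q :=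
    fun k hq => analyticAt_const.add
      ((analyticAt_altVal hq).div (analyticAt_id.pow k) (pow_ne_zero k (by simp; linarith)))
  have hW : ∀ q, 1 < q → AnalyticAt ℝ (fun q => wordMap q w (1 + altVal q / q ^ k)) q :=
    fun q hq => analyticAt_wordMap w (hT k hq)
  have hD : ∀ q, 1 < q → AnalyticAt ℝ (fun q => (1 + altVal q / q ^ k') / q) q :=
    fun q hq => (hT k' hq).div analyticAt_id (by simp; linarith)
  have hE : ∀ q, 1 < q → AnalyticAt ℝ (fun q : ℝ => 1 / (q - 1)) q :=
    fun q hq => analyticAt_const.div (analyticAt_id.sub analyticAt_const)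
      (by simp; linarith)
  have h4 : ∀ n : ℕ, 0 < altVal 4 / 4 ^ n ∧ altVal 4 / 4 ^ n ≤ 1 := by
    intro n
    have ha : altVal 4 = 4 / 15 := by norm_num [altVal]
    refine ⟨by rw [ha]; positivity, ?_⟩
    rw [div_le_one (by positivity), ha]
    exact (by norm_num : (4 / 15 : ℝ) ≤ 1).trans (one_le_pow₀ (by norm_num))
  have h5 := one_le_wordMap (by norm_num : (2 : ℝ) ≤ 4) w
    (by linarith [(h4 k).1] : (1 : ℝ) ≤ 1 + altVal 4 / 4 ^ k)
  have h6 := h4 k'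
  have r1 := eventually_ne_zero_of_analytic (fun q hq => (hW q hq).sub (hD q hq))
    (by norm_num : (1 : ℝ) < 4) (ne_of_gt (by simp only [Pi.sub_apply]; linarith)) hq
  have r2 := eventually_ne_zero_of_analytic (fun q hq => (hW q hq).sub ((hE q hq).sub (hD q hq)))
    (by norm_num : (1 : ℝ) < 4) (ne_of_gt (by simp only [Pi.sub_apply]; norm_num; linarith)) hq
  filter_upwards [r1, r2] with q' h1 h2
  exact ⟨sub_ne_zero.1 h1, sub_ne_zero.1 h2⟩

theorem continuousAt_leftJ {q : ℝ} (hq : 1 < q) : ContinuousAt leftJ q := by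
  have : (q - 1) * (q ^ 2 + 1) ≠ 0 := mul_ne_zero (by linarith) (by positivity)
  unfold leftJ
  fun_prop (disch := assumption)

/-- Near a base of the band, other than `q_2`, no other base of the band lies in `B_{ℵ₀}`. -/
theorem InBand.eventually_not_mem {q : ℝ} (h : InBand q) (hq2 : q ^ 4 ≠ 2 * q ^ 2 + q + 1) :
    ∀ᶠ q' in 𝓝[≠] q, InBand q' → q' ^ 4 ≠ 2 * q' ^ 2 + q' + 1 → q' ∉ BAleph0 := by
  have hq := h.one_lt
  set r := (1 + q) / 2 with hr
  have hr1 : 1 < r := by rw [hr]; linarith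
  have hrq : ∀ᶠ q' in 𝓝 q, r < q' := eventually_gt_nhds (by rw [hr]; linarith)
  have hl := h.one_lt_mul_leftJ
  set c := (q * leftJ q - 1) / 2 with hc
  have hc0 : 0 < c := by rw [hc]; linarith
  have hJ : ∀ᶠ q' in 𝓝 q, c < q' * leftJ q' - 1 :=
    continuousAt_const.eventually_lt
      ((continuousAt_id.mul (continuousAt_leftJ hq)).sub continuousAt_const)
      (by linarith)
  obtain ⟨K, hK⟩ := pow_unbounded_of_one_lt (1 / c) hr1
  rw [div_lt_iff₀ hc0] at hK
  set g : ℕ → ℕ → ℝ → ℝ := fun k j q' =>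
    |q' ^ j * (1 / (q' - 1) - 1 - altVal q' / q' ^ k) - altVal q'| with hg
  have hgc : ∀ k j, ContinuousAt (g k j) q := by
    intro k j
    have h1 : q - 1 ≠ 0 := by linarith
    have h2 : q ^ k ≠ 0 := pow_ne_zero _ (by linarith)
    have h3 := (analyticAt_altVal hq).continuousAt
    rw [hg]
    fun_prop (disch := assumption)
  have hg0 : ∀ k j, 0 < g k j q := by
    intro k j
    refine abs_pos.2 fun h0 => h.end_sub_one_ne hq2 k j ?_
    have hp : 0 < q ^ j := pow_pos (by linarith) j
    have h1 : q ^ j * (1 / (q - 1) - 1 - altVal q / q ^ k) = altVal q := by linarith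
    have h2 : altVal q / q ^ j = 1 / (q - 1) - 1 - altVal q / q ^ k := by
      rw [div_eq_iff hp.ne', mul_comm, h1]
    linarith
  obtain ⟨d, hd, hd0⟩ : ∃ d : ℝ, (∀ k < K, ∀ j < K, d < g k j q) ∧ 0 < d := by
    have : ∀ᶠ d in 𝓝[>] (0 : ℝ), (∀ k < K, ∀ j < K, d < g k j q) ∧ 0 < d := by
      refine Filter.Eventually.and ?_ self_mem_nhdsWithin
      refine (eventually_all_finite (finite_Iio K)).2 fun k _ =>
        (eventually_all_finite (finite_Iio K)).2 fun j _ => ?_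
      exact (eventually_lt_nhds (hg0 k j)).filter_mono nhdsWithin_le_nhds
    exact this.exists
  obtain ⟨M, hM⟩ := pow_unbounded_of_one_lt (1 / d) hr1
  rw [div_lt_iff₀ hd0] at hM
  have hG : ∀ᶠ q' in 𝓝 q, ∀ k < K, ∀ j < K, d < g k j q' :=
    (eventually_all_finite (finite_Iio K)).2 fun k hk =>
      (eventually_all_finite (finite_Iio K)).2 fun j hj =>
        continuousAt_const.eventually_lt (hgc k j) (hd k hk j hj)
  have hR : ∀ᶠ q' in 𝓝[≠] q, ∀ w : List (Fin 2), w.length ≤ K + 2 * M + 4 → ∀ k < K, ∀ k' < K,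
      wordMap q' w (1 + altVal q' / q' ^ k) ≠ (1 + altVal q' / q' ^ k') / q' ∧
      wordMap q' w (1 + altVal q' / q' ^ k) ≠ 1 / (q' - 1) - (1 + altVal q' / q' ^ k') / q' :=
    (eventually_all_finite (List.finite_length_le (Fin 2) _)).2 fun w _ =>
      (eventually_all_finite (finite_Iio K)).2 fun k _ =>
        (eventually_all_finite (finite_Iio K)).2 fun k' _ => relation_eventually_ne hq w k k'
  filter_upwards [hR, (hrq.and (hJ.and hG)).filter_mono nhdsWithin_le_nhds] with
    q' hR ⟨hrq, hJ, hG⟩ h' hq2' hB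
  obtain ⟨A, hA, hS⟩ := exists_isNullOrbit hB (not_both_UniqSet h' hq2')
  have hpow : ∀ n : ℕ, r ^ n ≤ q' ^ n := fun n => by gcongr
  have hK' : 1 ≤ q' ^ K * (q' * leftJ q' - 1) := by
    refine hK.le.trans ?_
    have := hpow K
    have : 0 ≤ q' ^ K := pow_nonneg (by linarith) K
    gcongr
  have hM' : ∀ k < K, ∀ j < K, 1 ≤ q' ^ (2 * M) * g k j q' := by
    intro k hk j hj
    refine hM.le.trans ?_
    have h1 : r ^ M ≤ q' ^ (2 * M) :=
      (pow_le_pow_right₀ hr1.le (by omega)).trans (hpow (2 * M))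
    have := hG k hk j hj
    have : 0 ≤ q' ^ (2 * M) := pow_nonneg (by linarith) _
    gcongr
  obtain ⟨w, hw, k, hk, k', hk', e⟩ := hA.exists_relation h' hK' hM' hS
  exact e.elim (hR w hw k hk k' hk').1 (hR w hw k hk k' hk').2

/-- For `q` near the golden ratio the orbit cannot pass through a point close to `1/q`. -/
theorem IsNullOrbit.not_mem_near_golden {q : ℝ} {A : Set ℝ} (hA : IsNullOrbit q A) (h : InBand q)
    (hq2 : q ^ 4 ≠ 2 * q ^ 2 + q + 1) {k j : ℕ} {y : ℝ}
    (e : y = q ^ j * (1 / (q - 1) - 1 - altVal q / q ^ k))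
    (h1 : q ^ 4 * y < leftJ q + 1 + q ^ 2)
    (h2 : q ^ 4 * (1 / (q - 1) - q * y) < leftJ q + 1 + q ^ 2) (h3 : 1 < q * (q * y))
    (h4 : q ^ 4 * (q - 1) < leftJ q + 1 + q ^ 2)
    (h5 : q ^ 4 * (1 / (q - 1) - q * (1 / (q - 1) - 1)) < leftJ q + 1 + q ^ 2) : y ∉ A := by
  intro hy
  have hq := h.one_lt
  have hq4 : 0 < q ^ 4 := by positivity
  have hy1 : q * y < 1 := by
    by_contra hc
    linarith [hA.switch_ge h hy (not_lt.1 hc)]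
  have hne : q * y ≠ altVal q := by
    intro hc
    refine h.end_sub_one_ne hq2 k (j + 1) ?_
    have h6 : altVal q / q ^ (j + 1) = 1 / (q - 1) - 1 - altVal q / q ^ k := by
      rw [div_eq_iff (by positivity)]
      linear_combination q * e - hc
    linarith
  have hpos : 0 < |q * y - altVal q| := abs_pos.2 (sub_ne_zero.2 hne)
  obtain ⟨M, hM⟩ := pow_unbounded_of_one_lt (1 / |q * y - altVal q|) hq
  rw [div_lt_iff₀ hpos] at hM
  have hM' : 1 ≤ q ^ (2 * M) * |q * y - altVal q| := by
    refine hM.le.trans ?_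
    gcongr
    · exact hq.le
    · omega
  obtain ⟨z, hz, -, hz1, hz2, rfl | hz3 | hz3⟩ := hA.gap_to_switch h M (hA.lt hy hy1) h3.le hy1 hM'
  · linarith [hA.switch_le h hz hz2]
  · have := hA.switch_ge h hz hz1
    have : q ^ 4 * z ≤ q ^ 4 * (q - 1) := by gcongr
    linarith
  · have := hA.switch_le h hz hz2
    have : q ^ 4 * (1 / (q - 1) - z) ≤ q ^ 4 * (1 / (q - 1) - q * (1 / (q - 1) - 1)) := by gcongr
    linarith

/-- Near the golden ratio, no base of the band other than `q_2` lies in `B_{ℵ₀}`. -/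
theorem eventually_not_mem_of_golden {G : ℝ} (hG1 : 1 < G) (hG : G ^ 2 = G + 1) :
    ∀ᶠ q in 𝓝 G, InBand q → q ^ 4 ≠ 2 * q ^ 2 + q + 1 → q ∉ BAleph0 := by
  have b1 : 1.618 < G := by nlinarith
  have b2 : G < 1.6181 := by nlinarith
  have ha : 1 / (G - 1) = G := by
    rw [div_eq_iff (by linarith)]
    linarith
  have hp : altVal G = 1 := by
    unfold altVal
    rw [div_eq_one_iff_eq (by nlinarith)]
    linarith
  have hG3 : G ^ 3 = 2 * G + 1 := by linear_combination (G + 1) * hG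
  have hG4 : G ^ 4 = 3 * G + 2 := by linear_combination (G ^ 2 + G + 2) * hG
  have hl : leftJ G = G / (2 * G - 1) := by
    unfold leftJ
    congr 1
    linear_combination G * hG
  have l1 : 0.723 < leftJ G := by
    rw [hl, lt_div_iff₀ (by linarith)]
    linarith
  have l2 : leftJ G < 0.724 := by
    rw [hl, div_lt_iff₀ (by linarith)]
    linarith
  have i1 : 1 / G = G - 1 := by
    rw [div_eq_iff (by linarith)]
    linarith
  have i2 : 1 / G ^ 2 = 2 - G := by
    rw [div_eq_iff (by positivity)]
    linear_combination (G - 1) * hG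
  have i3 : 1 / G ^ 3 = 2 * G - 3 := by
    rw [div_eq_iff (by positivity)]
    linear_combination (-2 * G ^ 2 + G - 1) * hG
  have cl := continuousAt_leftJ hG1
  have cp := (analyticAt_altVal hG1).continuousAt
  have ce : ContinuousAt (fun q : ℝ => 1 / (q - 1)) G := by
    have : G - 1 ≠ 0 := by linarith
    fun_prop (disch := assumption)
  have cd : ∀ k : ℕ, ContinuousAt (fun q : ℝ => altVal q / q ^ k) G := by
    intro k
    have : G ^ k ≠ 0 := pow_ne_zero _ (by linarith)
    fun_prop (disch := assumption)
  have cv : ∀ k j : ℕ,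
      ContinuousAt (fun q : ℝ => q ^ j * (1 / (q - 1) - 1 - altVal q / q ^ k)) G := by
    intro k j
    have := cd k
    fun_prop
  have cB : ContinuousAt (fun q : ℝ => leftJ q + 1 + q ^ 2) G := by fun_prop
  have y2 : G ^ 2 * (1 / (G - 1) - 1 - altVal G / G ^ 2) = G - 1 := by
    rw [ha, hp, i2]
    linear_combination (2 * G - 1) * hG
  have y3 : G ^ 1 * (1 / (G - 1) - 1 - altVal G / G ^ 3) = G - 1 := by
    rw [ha, hp, i3]
    linear_combination -hG
  have near : ∀ k j : ℕ, G ^ j * (1 / (G - 1) - 1 - altVal G / G ^ k) = G - 1 →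
      ∀ᶠ q in 𝓝 G, q ^ 4 * (q ^ j * (1 / (q - 1) - 1 - altVal q / q ^ k)) <
          leftJ q + 1 + q ^ 2 ∧
        q ^ 4 * (1 / (q - 1) - q * (q ^ j * (1 / (q - 1) - 1 - altVal q / q ^ k))) <
          leftJ q + 1 + q ^ 2 ∧
        1 < q * (q * (q ^ j * (1 / (q - 1) - 1 - altVal q / q ^ k))) := by
    intro k j hkj
    have := cv k j
    refine Filter.Eventually.and (ContinuousAt.eventually_lt (by fun_prop) cB ?_)
      (Filter.Eventually.and (ContinuousAt.eventually_lt (by fun_prop) cB ?_)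
        (continuousAt_const.eventually_lt (by fun_prop) ?_))
    · rw [hkj, hG4]
      nlinarith
    · rw [hkj, hG4, ha]
      nlinarith
    · rw [hkj]
      nlinarith
  have t1 : ∀ᶠ q in 𝓝 G, 1 < q ^ 4 * (q * leftJ q - 1) := by
    refine continuousAt_const.eventually_lt (by fun_prop) ?_
    rw [hG4]
    nlinarith
  have t2 : ∀ᶠ q in 𝓝 G, 1 / (q - 1) - q * leftJ q < altVal q / q := by
    have := cd 1
    simp only [pow_one] at this
    refine ContinuousAt.eventually_lt (by fun_prop) this ?_
    rw [ha, hp, i1]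
    nlinarith
  have t3 : ∀ᶠ q in 𝓝 G, q ^ 4 * (q - 1) < leftJ q + 1 + q ^ 2 := by
    refine ContinuousAt.eventually_lt (by fun_prop) cB ?_
    rw [hG4]
    nlinarith
  have t4 : ∀ᶠ q in 𝓝 G,
      q ^ 4 * (1 / (q - 1) - q * (1 / (q - 1) - 1)) < leftJ q + 1 + q ^ 2 := by
    refine ContinuousAt.eventually_lt (by fun_prop) cB ?_
    rw [hG4, ha]
    nlinarith
  have small : ∀ k j : ℕ, G * (G ^ j * (1 / (G - 1) - 1 - altVal G / G ^ k)) < 1 →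
      ∀ᶠ q in 𝓝 G, q * (q ^ j * (1 / (q - 1) - 1 - altVal q / q ^ k)) < 1 := by
    intro k j hkj
    have := cv k j
    exact ContinuousAt.eventually_lt (by fun_prop) continuousAt_const hkj
  have s1 := small 2 0 (by rw [ha, hp, i2]; nlinarith)
  have s2 := small 2 1 (by rw [ha, hp, i2]; nlinarith)
  have s3 := small 3 0 (by rw [ha, hp, i3]; nlinarith)
  filter_upwards [near 2 2 y2, near 3 1 y3, t1, t2, t3, t4, s1, s2, s3] with
    q n2 n3 t1 t2 t3 t4 s1 s2 s3 h hq2 hB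
  obtain ⟨A, hA, x, hx, hx1, hx2⟩ := exists_isNullOrbit hB (not_both_UniqSet h hq2)
  have hq := h.one_lt
  obtain ⟨y, y1, -, y3, y4⟩ := hA.switch_to_J h hx hx1 hx2
  obtain ⟨z, z1, k, hk, z3, z4⟩ : ∃ z, z ≤ 1 / (q - 1) - leftJ q ∧
      ∃ k < 4, q * z ∈ A ∧ q * z = 1 + altVal q / q ^ k := by
    obtain ⟨k, hk, h6 | h6⟩ := hA.J_form h t1.le y1 y3 y4
    · exact ⟨y, y4, k, hk, h6⟩
    · exact ⟨_, by linarith, k, hk, h6⟩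
  have hv := hA.symm _ z3
  have hve : 1 / (q - 1) - q * z = 1 / (q - 1) - 1 - altVal q / q ^ k := by linarith
  rw [hve] at hv
  have hk2 : 2 ≤ k := by
    by_contra hc
    have h7 : q * z ≤ q * (1 / (q - 1) - leftJ q) := by gcongr
    have h8 := reflect_mul hq (leftJ q)
    have h9 : altVal q / q ≤ altVal q / q ^ k := by
      have := h.altVal_pos
      gcongr
      exact (pow_le_pow_right₀ hq.le (show k ≤ 1 by omega)).trans_eq (pow_one q)
    linarith
  obtain rfl | rfl : k = 2 ∨ k = 3 := by omega
  · refine hA.not_mem_near_golden h hq2 rfl n2.1 n2.2.1 n2.2.2 t3 t4 (hA.scale_mem hv ?_)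
    intro i hi
    interval_cases i
    exacts [s1, s2]
  · refine hA.not_mem_near_golden h hq2 rfl n3.1 n3.2.1 n3.2.2 t3 t4 (hA.scale_mem hv ?_)
    intro i hi
    interval_cases i
    exact s3

theorem InBand.of_mem {q qf : ℝ} (hqf1 : qf ∈ Ioo (1 : ℝ) 2)
    (hqf2 : qf ^ 3 = 2 * qf ^ 2 - qf + 1) (h1 : (1 + √5) / 2 < q) (h2 : q < qf) : InBand q := by
  have h5 := Real.sq_sqrt (show (0 : ℝ) ≤ 5 by norm_num)
  have h5' : 2 < √5 := Real.lt_sqrt_of_sq_lt (by norm_num)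
  have hq : 1.5 < q := by linarith
  have hgold : q + 1 < q ^ 2 := by nlinarith
  refine ⟨by linarith, by linarith [hqf1.2], hgold, ?_⟩
  by_contra hc
  have h3 : 0 < (qf - q) * (qf ^ 2 + qf * q + q ^ 2 - 2 * (qf + q) + 1) :=
    mul_pos (by linarith) (by nlinarith)
  nlinarith

theorem quartic_ne_of_ne {q q2 : ℝ} (h1 : 1 < q) (h2 : 1 < q2)
    (hq2 : q2 ^ 4 = 2 * q2 ^ 2 + q2 + 1) (hne : q ≠ q2) : q ^ 4 ≠ 2 * q ^ 2 + q + 1 := by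
  intro hc
  have h3 : (q - q2) * ((q + q2) * (q ^ 2 + q2 ^ 2 - 2) - 1) = 0 := by
    linear_combination hc - hq2
  rcases mul_eq_zero.1 h3 with h4 | h4
  · exact hne (by linarith)
  · have e1 : 1.5 < q := by
      by_contra h5
      nlinarith [mul_nonneg (sub_nonneg.2 h1.le) (sub_nonneg.2 (not_lt.1 h5)),
        sq_nonneg (q ^ 2 - 1)]
    have e2 : 1.5 < q2 := by
      by_contra h5
      nlinarith [mul_nonneg (sub_nonneg.2 h2.le) (sub_nonneg.2 (not_lt.1 h5)),
        sq_nonneg (q2 ^ 2 - 1)]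
    nlinarith [mul_pos (show 0 < q + q2 - 3 by linarith) (show 0 < q ^ 2 + q2 ^ 2 - 2 by nlinarith)]

/-- `B_{ℵ₀} ∩ ([(1+√5)/2, q_f) \ {q_2})` is a discrete set: each of its points
has a neighbourhood containing no other point of the set. -/
theorem BAleph0_discrete
    (qf : ℝ) (hqf1 : qf ∈ Set.Ioo (1 : ℝ) 2) (hqf2 : qf ^ 3 = 2 * qf ^ 2 - qf + 1)
    (q2 : ℝ) (hq21 : q2 ∈ Set.Ioo (1 : ℝ) 2) (hq22 : q2 ^ 4 = 2 * q2 ^ 2 + q2 + 1) :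
    ∀ q ∈ BAleph0 ∩ (Set.Ico ((1 + Real.sqrt 5) / 2) qf \ {q2}),
      ∃ ε > (0 : ℝ), ∀ q' ∈ BAleph0 ∩ (Set.Ico ((1 + Real.sqrt 5) / 2) qf \ {q2}),
        |q' - q| < ε → q' = q := by
  rintro q ⟨hB, hq, hqne⟩
  have key : ∀ᶠ q' in 𝓝[≠] q, (1 + Real.sqrt 5) / 2 < q' → q' < qf → q' ≠ q2 → q' ∉ BAleph0 := by
    rcases hq.1.eq_or_lt with hG | hG
    · refine ((eventually_not_mem_of_golden hB.1.1 ?_).filter_mono nhdsWithin_le_nhds).mono ?_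
      · have := Real.sq_sqrt (show (0 : ℝ) ≤ 5 by norm_num)
        rw [← hG]
        linarith
      · intro q' h h1 h2 h3
        have hb := InBand.of_mem hqf1 hqf2 h1 h2
        exact h hb (quartic_ne_of_ne hb.one_lt hq21.1 hq22 h3)
    · have hb := InBand.of_mem hqf1 hqf2 hG hq.2
      refine (hb.eventually_not_mem (quartic_ne_of_ne hb.one_lt hq21.1 hq22 hqne)).mono ?_
      intro q' h h1 h2 h3
      have hb := InBand.of_mem hqf1 hqf2 h1 h2
      exact h hb (quartic_ne_of_ne hb.one_lt hq21.1 hq22 h3)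
  have key' : ∀ᶠ q' in 𝓝[≠] q,
      q' ∉ BAleph0 ∩ (Set.Ico ((1 + Real.sqrt 5) / 2) qf \ {q2}) := by
    rcases hq.1.eq_or_lt with hG | hG
    · filter_upwards [key, self_mem_nhdsWithin] with q' h hne ⟨hB', hq', hne'⟩
      exact h (lt_of_le_of_ne hq'.1 fun hc => hne (hc.symm.trans hG)) hq'.2 hne' hB'
    · filter_upwards [key, (eventually_gt_nhds hG).filter_mono nhdsWithin_le_nhds] with
        q' h hlt ⟨hB', hq', hne'⟩
      exact h hlt hq'.2 hne' hB'
  rw [eventually_nhdsWithin_iff, Metric.eventually_nhds_iff] at key'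
  obtain ⟨ε, hε, h⟩ := key'
  refine ⟨ε, hε, fun q' hq' hd => ?_⟩
  by_contra hne
  exact h (by rwa [Real.dist_eq]) hne hq'
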